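/- arXiv:quant-ph/0504008 — 4 statements merged into one kernel-verified Lean document; each statement's English description precedes it below -/
import Mathlib

section
/- Let X be a finite nonempty set and let E : X → { density matrices on ℂ^d } be an encoding such that E(x) is positive definite for every x ∈ X. Then there exists a probability distribution μ on X such that for every x ∈ X, S(E(x) ‖ ρ_μ) ≤ T(E), where ρ_μ = Σ_{x∈X} μ(x)·E(x) and T(E) = sup over probability distributions λ on X of Σ_{x∈X} λ(x)·S(E(x) ‖ ρ_λ). -/
open Matrix
open scoped ComplexOrder

/-- Matrix logarithm: `Real.log` applied to the eigenvalues via the continuous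
functional calculus. -/
noncomputable def matLog {n : Type*} [Fintype n] [DecidableEq n]
    (ρ : Matrix n n ℂ) : Matrix n n ℂ :=
  cfc Real.log ρ

/-- Quantum relative entropy `S(ρ‖σ) = Re (tr (ρ (log ρ - log σ)))`. -/
noncomputable def qRelEnt {n : Type*} [Fintype n] [DecidableEq n]
    (ρ σ : Matrix n n ℂ) : ℝ :=
  (Matrix.trace (ρ * (matLog ρ - matLog σ))).re

/-- A probability distribution on a finite set. -/
def IsProbVec {X : Type*} [Fintype X] (μ : X → ℝ) : Prop :=
  (∀ x, 0 ≤ μ x) ∧ ∑ x, μ x = 1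

namespace Matrix

/-- Overlap formula for the trace of a product of two functions of Hermitian matrices. -/
lemma IsHermitian.re_trace_cfc_mul_cfc {n : Type*} [Fintype n] [DecidableEq n]
    {A B : Matrix n n ℂ} (hA : A.IsHermitian) (hB : B.IsHermitian) (f g : ℝ → ℝ) :
    (trace (cfc f A * cfc g B)).re =
      ∑ i, ∑ j, f (hA.eigenvalues i) * g (hB.eigenvalues j) *
        Complex.normSq ((star (hA.eigenvectorUnitary : Matrix n n ℂ) *
          (hB.eigenvectorUnitary : Matrix n n ℂ)) i j) := by
  rw [hA.cfc_eq, hB.cfc_eq, IsHermitian.cfc, IsHermitian.cfc, Unitary.conjStarAlgAut_apply,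
    Unitary.conjStarAlgAut_apply]
  set U : Matrix n n ℂ := ↑hA.eigenvectorUnitary
  set V : Matrix n n ℂ := ↑hB.eigenvectorUnitary
  set D : Matrix n n ℂ := diagonal (RCLike.ofReal ∘ f ∘ hA.eigenvalues) with hD
  set D' : Matrix n n ℂ := diagonal (RCLike.ofReal ∘ g ∘ hB.eigenvalues) with hD'
  have hcycle : trace (U * D * star U * (V * D' * star V)) =
      trace (D * (star U * V) * (D' * star (star U * V))) := by
    rw [star_mul, star_star, mul_assoc U D, mul_assoc U, trace_mul_comm U]
    simp only [mul_assoc]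
  rw [hcycle, trace, Complex.re_sum]
  refine Finset.sum_congr rfl fun i _ => ?_
  rw [diag_apply, mul_apply, Complex.re_sum]
  refine Finset.sum_congr rfl fun j _ => ?_
  rw [hD, hD', diagonal_mul, diagonal_mul, star_apply]
  set w := (star U * V) i j
  simp only [Function.comp_apply, Complex.coe_algebraMap, RCLike.star_def]
  simp [Complex.normSq_apply]
  ring

/-- **Klein's inequality** for positive definite matrices. -/
theorem PosDef.re_trace_sub_le_qRelEnt {n : Type*} [Fintype n] [DecidableEq n]
    {ρ σ : Matrix n n ℂ} (hρ : ρ.PosDef) (hσ : σ.PosDef) :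
    (trace (ρ - σ)).re ≤ qRelEnt ρ σ := by
  have h1 := hρ.1
  have h2 := hσ.1
  have s1 : IsSelfAdjoint ρ := h1
  have s2 : IsSelfAdjoint σ := h2
  have hcont : ∀ (h : ℝ → ℝ) (A : Matrix n n ℂ), ContinuousOn h (spectrum ℝ A) := fun h A =>
    A.finite_real_spectrum.continuousOn h
  have e1 := h1.re_trace_cfc_mul_cfc h2 (fun x => x) (fun _ => 1)
  have e2 := h1.re_trace_cfc_mul_cfc h2 (fun _ => 1) (fun x => x)
  have e3 := h1.re_trace_cfc_mul_cfc h2 (fun x => x * Real.log x) (fun _ => 1)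
  have e4 := h1.re_trace_cfc_mul_cfc h2 (fun x => x) Real.log
  rw [cfc_mul (fun x : ℝ => x) Real.log ρ (hcont _ _) (hcont _ _)] at e3
  simp only [cfc_id' ℝ ρ, cfc_id' ℝ σ, cfc_const_one ℝ ρ, cfc_const_one ℝ σ, mul_one, one_mul]
    at e1 e2 e3 e4
  rw [qRelEnt, mul_sub, trace_sub, trace_sub, Complex.sub_re, Complex.sub_re, matLog, matLog,
    e1, e2, e3, e4]
  simp only [← Finset.sum_sub_distrib]
  refine Finset.sum_le_sum fun i _ => Finset.sum_le_sum fun j _ => ?_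
  have hp := hρ.eigenvalues_pos i
  have hq := hσ.eigenvalues_pos j
  set p := h1.eigenvalues i
  set q := h2.eigenvalues j
  have hlog : p - q ≤ p * Real.log p - p * Real.log q := by
    have h := Real.log_le_sub_one_of_pos (div_pos hq hp)
    rw [Real.log_div hq.ne' hp.ne'] at h
    have h' := mul_le_mul_of_nonneg_left h hp.le
    have : p * (q / p - 1) = q - p := by field_simp
    linarith
  simpa only [sub_mul] using mul_le_mul_of_nonneg_right hlog (Complex.normSq_nonneg _)

theorem convex_setOf_posDef {n : Type*} [Fintype n] :
    Convex ℝ {A : Matrix n n ℂ | A.PosDef} := by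
  intro A hA B hB a b ha hb hab
  rcases ha.eq_or_lt with rfl | ha
  · obtain rfl : b = 1 := by linarith
    simpa using hB
  · exact (PosDef.smul hA ha).add_posSemidef (PosSemidef.smul (PosDef.posSemidef hB) hb)

open scoped Matrix.Norms.L2Operator in
theorem continuousOn_matLog {n : Type*} [Fintype n] [DecidableEq n] :
    ContinuousOn matLog {A : Matrix n n ℂ | A.PosDef} :=
  (CFC.continuousOn_log (A := Matrix n n ℂ)).mono fun _ hA => ⟨hA.1, hA.isUnit⟩

end Matrix

section Ensemble

variable {X n : Type*} [Fintype X] [Fintype n]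

lemma IsProbVec.posDef_sum {μ : X → ℝ} (hμ : IsProbVec μ) {E : X → Matrix n n ℂ}
    (hpd : ∀ x, (E x).PosDef) : (∑ y, μ y • E y).PosDef :=
  convex_setOf_posDef.sum_mem (fun y _ => hμ.1 y) hμ.2 fun y _ => hpd y

lemma IsProbVec.trace_sum {μ : X → ℝ} (hμ : IsProbVec μ) {E : X → Matrix n n ℂ}
    (htr : ∀ x, (E x).trace = 1) : (∑ y, μ y • E y).trace = 1 := by
  simp only [Matrix.trace_sum, trace_smul, htr, ← Finset.sum_smul, hμ.2, one_smul]

lemma re_trace_sum_smul_mul (μ : X → ℝ) (E : X → Matrix n n ℂ) (M : Matrix n n ℂ) :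
    (trace ((∑ y, μ y • E y) * M)).re = ∑ y, μ y * (trace (E y * M)).re := by
  simp [Finset.sum_mul, Matrix.trace_sum]

variable [DecidableEq n]

/-- **Donald's identity**. -/
theorem sum_mul_qRelEnt (μ : X → ℝ) (E : X → Matrix n n ℂ) (σ : Matrix n n ℂ) :
    ∑ x, μ x * qRelEnt (E x) σ =
      ∑ x, μ x * qRelEnt (E x) (∑ y, μ y • E y) + qRelEnt (∑ y, μ y • E y) σ := by
  have h : ∀ τ : Matrix n n ℂ, ∑ x, μ x * qRelEnt (E x) τ =
      ∑ x, μ x * (trace (E x * matLog (E x))).re - (trace ((∑ y, μ y • E y) * matLog τ)).re := by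
    intro τ
    simp only [qRelEnt, mul_sub, trace_sub, Complex.sub_re, Finset.sum_sub_distrib,
      re_trace_sum_smul_mul]
  rw [h, h, qRelEnt, mul_sub, trace_sub, Complex.sub_re]
  ring

lemma isProbVec_single [DecidableEq X] (x : X) : IsProbVec (Pi.single x (1 : ℝ)) :=
  single_mem_stdSimplex ℝ x

lemma continuousOn_qRelEnt_sum {E : X → Matrix n n ℂ} (hpd : ∀ x, (E x).PosDef)
    (ρ : Matrix n n ℂ) :
    ContinuousOn (fun μ : X → ℝ => qRelEnt ρ (∑ y, μ y • E y)) (stdSimplex ℝ X) := by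
  have hsum : Continuous fun μ : X → ℝ => ∑ y, μ y • E y := by fun_prop
  have hlog : ContinuousOn (fun μ : X → ℝ => matLog (∑ y, μ y • E y)) (stdSimplex ℝ X) :=
    continuousOn_matLog.comp hsum.continuousOn fun μ hμ => IsProbVec.posDef_sum hμ hpd
  have htrace : Continuous fun M : Matrix n n ℂ => (trace (ρ * (matLog ρ - M))).re :=
    Complex.continuous_re.comp (Continuous.matrix_trace (by fun_prop))
  exact htrace.comp_continuousOn hlog

/-- At a distribution maximising the average relative entropy to the mean state, no signal state
lies farther from the mean than the maximum. -/
theorem qRelEnt_le_of_isMaxOn {E : X → Matrix n n ℂ} (hpd : ∀ x, (E x).PosDef)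
    (htr : ∀ x, (E x).trace = 1) {μ : X → ℝ} (hμ : IsProbVec μ)
    (hmax : IsMaxOn (fun l : X → ℝ => ∑ x, l x * qRelEnt (E x) (∑ y, l y • E y))
      (stdSimplex ℝ X) μ) (x : X) :
    qRelEnt (E x) (∑ y, μ y • E y) ≤ ∑ z, μ z * qRelEnt (E z) (∑ y, μ y • E y) := by
  classical
  set c := ∑ z, μ z * qRelEnt (E z) (∑ y, μ y • E y) with hc
  let ν : ℝ → X → ℝ := fun t => (1 - t) • μ + t • Pi.single x 1
  have hν : ∀ t ∈ Set.Icc (0 : ℝ) 1, ν t ∈ stdSimplex ℝ X := fun t ht =>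
    convex_stdSimplex ℝ X hμ (isProbVec_single x) (by linarith [ht.2]) ht.1 (by ring)
  have hbound : ∀ t ∈ Set.Ioc (0 : ℝ) 1, qRelEnt (E x) (∑ y, ν t y • E y) ≤ c := by
    intro t ht
    have hνt := hν t ⟨ht.1.le, ht.2⟩
    set σ := ∑ y, ν t y • E y with hσ
    have hklein : 0 ≤ qRelEnt (∑ y, μ y • E y) σ := by
      have h := (hμ.posDef_sum hpd).re_trace_sub_le_qRelEnt (IsProbVec.posDef_sum hνt hpd)
      rwa [trace_sub, hμ.trace_sum htr, IsProbVec.trace_sum hνt htr, sub_self,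
        Complex.zero_re] at h
    have hsplit : ∑ z, ν t z * qRelEnt (E z) σ =
        (1 - t) * ∑ z, μ z * qRelEnt (E z) σ + t * qRelEnt (E x) σ := by
      simp [ν, add_mul, Finset.sum_add_distrib, Finset.mul_sum, mul_assoc, Pi.single_apply]
    have hle : ∑ z, ν t z * qRelEnt (E z) σ ≤ c := hmax hνt
    rw [hsplit, sum_mul_qRelEnt, ← hc] at hle
    have h0 : 0 ≤ (1 - t) * qRelEnt (∑ y, μ y • E y) σ :=
      mul_nonneg (by linarith [ht.2]) hklein
    refine le_of_mul_le_mul_left ?_ ht.1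
    linarith
  have hν0 : ν 0 = μ := by simp [ν]
  have hcont : ContinuousOn (fun t => qRelEnt (E x) (∑ y, ν t y • E y)) (Set.Icc 0 1) :=
    (continuousOn_qRelEnt_sum hpd (E x)).comp (by fun_prop) hν
  have hlim := ((hcont 0 (by simp)).mono Set.Ioc_subset_Icc_self).tendsto
  simp only [hν0] at hlim
  have : (nhdsWithin (0 : ℝ) (Set.Ioc 0 1)).NeBot := by
    rw [nhdsWithin_Ioc_eq_nhdsGT one_pos]; infer_instance
  exact le_of_tendsto hlim (eventually_nhdsWithin_of_forall hbound)

end Ensemble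

/-- There is a distribution `μ` such that every `S(E(x)‖ρ_μ)` is bounded by the
maximum possible information `T(E)`. -/
theorem stmt_0 {d : ℕ} {X : Type*} [Fintype X] [Nonempty X]
    (E : X → Matrix (Fin d) (Fin d) ℂ)
    (hpd : ∀ x, (E x).PosDef) (htr : ∀ x, (E x).trace = 1) :
    ∃ μ : X → ℝ, IsProbVec μ ∧
      ∀ x, qRelEnt (E x) (∑ y, μ y • E y) ≤
        ⨆ lam : {l : X → ℝ // IsProbVec l},
          ∑ x, lam.1 x * qRelEnt (E x) (∑ y, lam.1 y • E y) := by
  have hcont : ContinuousOn (fun l : X → ℝ => ∑ x, l x * qRelEnt (E x) (∑ y, l y • E y))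
      (stdSimplex ℝ X) :=
    continuousOn_finsetSum _ fun x _ =>
      (continuous_apply x).continuousOn.mul (continuousOn_qRelEnt_sum hpd (E x))
  have hne : (stdSimplex ℝ X).Nonempty := by
    classical
    exact ⟨_, isProbVec_single (Classical.arbitrary X)⟩
  obtain ⟨μ, hμ, hmax⟩ := (isCompact_stdSimplex ℝ X).exists_isMaxOn hne hcont
  refine ⟨μ, hμ, fun x => (qRelEnt_le_of_isMaxOn hpd htr hμ hmax x).trans ?_⟩
  refine le_ciSup (f := fun lam : {l : X → ℝ // IsProbVec l} =>
    ∑ x, lam.1 x * qRelEnt (E x) (∑ y, lam.1 y • E y)) ?_ ⟨μ, hμ⟩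
  exact ⟨_, Set.forall_mem_range.2 fun l => hmax l.2⟩
end

section
/- Let X be a finite nonempty set, Y a finite nonempty set, and E : X → {probability measures on Y}. Then there exists a probability distribution μ on X such that for every x ∈ X, klDiv(E(x) ‖ ρ_μ) ≤ T(E), where ρ_μ = Σ_{x∈X} μ(x)·E(x) (the mixture measure) and T(E) = sup over probability distributions λ on X of Σ_{x∈X} λ(x)·klDiv(E(x) ‖ ρ_λ) (the supremum taken in the extended reals). -/
open MeasureTheory
open scoped Classical

/-- Kullback–Leibler divergence between two measures, valued in the extended reals,
equal to `∞` when absolute continuity (or integrability of the log-likelihood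
ratio) fails. This matches Mathlib's `InformationTheory.klDiv`. -/
noncomputable def klDiv {α : Type*} [MeasurableSpace α] (μ ν : Measure α) : EReal :=
  if μ ≪ ν ∧ Integrable (llr μ ν) μ then ((∫ x, llr μ ν x ∂μ : ℝ) : EReal) else ⊤

section FiniteAlphabet

variable {X Y : Type*} [Fintype X] [Fintype Y]

/-- Gibbs' inequality, before summation. -/
lemma sub_le_mul_log_sub_mul_log {a b : ℝ} (ha : 0 ≤ a) (hb : 0 ≤ b) (hab : b = 0 → a = 0) :
    a - b ≤ a * Real.log a - a * Real.log b := by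
  rcases ha.eq_or_lt with rfl | ha
  · simpa using hb
  have hb : 0 < b := hb.lt_of_ne fun h ↦ ha.ne' (hab h.symm)
  have h := Real.log_le_sub_one_of_pos (div_pos hb ha)
  rw [Real.log_div hb.ne' ha.ne'] at h
  have h' := mul_le_mul_of_nonneg_left h ha.le
  have : a * (b / a - 1) = b - a := by field_simp
  linarith

/-- The mutual information functional, as a function of the input distribution. -/
noncomputable def mutualInfo (p : X → Y → ℝ) (l : X → ℝ) : ℝ :=
  ∑ x, l x * ∑ y, p x y * Real.log (p x y) + ∑ y, Real.negMulLog (∑ x, l x * p x y)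

lemma continuous_mutualInfo (p : X → Y → ℝ) : Continuous (mutualInfo p) := by
  unfold mutualInfo
  fun_prop

lemma mutualInfo_eq_sum_mul (p : X → Y → ℝ) (l : X → ℝ) :
    mutualInfo p l = ∑ x, l x * (∑ y, p x y * Real.log (p x y)
      - ∑ y, p x y * Real.log (∑ z, l z * p z y)) := by
  simp only [mutualInfo, sub_eq_add_neg, ← Finset.sum_neg_distrib,
    mul_add, Finset.sum_add_distrib, Real.negMulLog]
  congr 1
  simp only [Finset.mul_sum, Finset.sum_mul]
  rw [Finset.sum_comm]
  refine Finset.sum_congr rfl fun x _ ↦ Finset.sum_congr rfl fun y _ ↦ ?_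
  ring

/-- Moving from a maximizer `m` of the mutual information towards the input `x` cannot bring the
divergence of `p x` from the output distribution above the maximum. -/
lemma sum_sub_sum_log_le_of_isMax {p : X → Y → ℝ} (hp : ∀ x, IsProbVec (p x)) {m : X → ℝ}
    (hm : IsProbVec m) (hmax : ∀ l, IsProbVec l → mutualInfo p l ≤ mutualInfo p m)
    (x : X) {t : ℝ} (ht : 0 < t) (ht1 : t ≤ 1) :
    ∑ y, p x y * Real.log (p x y)
      - ∑ y, p x y * Real.log ((1 - t) * ∑ z, m z * p z y + t * p x y) ≤ mutualInfo p m := by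
  classical
  set l : X → ℝ := fun z ↦ (1 - t) * m z + t * (Pi.single x 1 : X → ℝ) z with hl
  set r : Y → ℝ := fun y ↦ ∑ z, m z * p z y with hr
  have hsum (f : X → ℝ) : ∑ z, l z * f z = (1 - t) * ∑ z, m z * f z + t * f x := by
    simp [hl, add_mul, Finset.sum_add_distrib, Finset.mul_sum, mul_assoc, Pi.single_apply]
  have hlp : IsProbVec l := by
    refine ⟨fun z ↦ ?_, by simpa [hm.2] using hsum 1⟩
    have : (0 : ℝ) ≤ (Pi.single x 1 : X → ℝ) z := by
      rw [Pi.single_apply]; split_ifs <;> norm_num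
    exact add_nonneg (mul_nonneg (by linarith) (hm.1 z)) (mul_nonneg ht.le this)
  have hr0 (y) : 0 ≤ r y := Finset.sum_nonneg fun z _ ↦ mul_nonneg (hm.1 z) ((hp z).1 y)
  have hr1 : ∑ y, r y = 1 := by
    simp only [hr]
    rw [Finset.sum_comm]
    simp [← Finset.mul_sum, (hp _).2, hm.2]
  have h := hmax l hlp
  simp only [mutualInfo, hsum, Real.negMulLog] at h ⊢
  change _ ≤ ∑ x, m x * ∑ y, p x y * Real.log (p x y) + ∑ y, -r y * Real.log (r y) at h
  change _ - ∑ y, p x y * Real.log ((1 - t) * r y + t * p x y) ≤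
    ∑ x, m x * ∑ y, p x y * Real.log (p x y) + ∑ y, -r y * Real.log (r y)
  change _ + ∑ y, -((1 - t) * r y + t * p x y) * Real.log ((1 - t) * r y + t * p x y) ≤ _ at h
  rcases ht1.eq_or_lt with rfl | ht1
  · simpa [sub_eq_add_neg] using h
  have hgibbs : ∑ y, r y - ∑ y, ((1 - t) * r y + t * p x y) ≤
      ∑ y, r y * Real.log (r y) - ∑ y, r y * Real.log ((1 - t) * r y + t * p x y) := by
    rw [← Finset.sum_sub_distrib, ← Finset.sum_sub_distrib]
    refine Finset.sum_le_sum fun y _ ↦ ?_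
    have h1 : 0 ≤ (1 - t) * r y := mul_nonneg (by linarith) (hr0 y)
    have h2 : 0 ≤ t * p x y := mul_nonneg ht.le ((hp x).1 y)
    refine sub_le_mul_log_sub_mul_log (hr0 y) (by positivity) fun h0 ↦ ?_
    have : (1 - t) * r y = 0 := by linarith
    exact (mul_eq_zero.1 this).resolve_left (by linarith)
  have hsplit : ∑ y, -((1 - t) * r y + t * p x y) * Real.log ((1 - t) * r y + t * p x y) =
      -(1 - t) * ∑ y, r y * Real.log ((1 - t) * r y + t * p x y)
        - t * ∑ y, p x y * Real.log ((1 - t) * r y + t * p x y) := by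
    rw [Finset.mul_sum, Finset.mul_sum, ← Finset.sum_sub_distrib]
    exact Finset.sum_congr rfl fun y _ ↦ by ring
  rw [Finset.sum_add_distrib, ← Finset.mul_sum, ← Finset.mul_sum, hr1, (hp x).2] at hgibbs
  rw [hsplit] at h
  simp only [neg_mul, Finset.sum_neg_distrib] at h ⊢
  have h3 : (1 - t) * ∑ y, r y * Real.log ((1 - t) * r y + t * p x y) ≤
      (1 - t) * ∑ y, r y * Real.log (r y) :=
    mul_le_mul_of_nonneg_left (by linarith) (by linarith)
  refine le_of_mul_le_mul_left ?_ ht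
  linarith

/-- A capacity-achieving input distribution: its output distribution dominates every `p x`, at
divergence at most the mutual information. -/
lemma exists_isProbVec_divergence_le [Nonempty X] {p : X → Y → ℝ} (hp : ∀ x, IsProbVec (p x)) :
    ∃ m : X → ℝ, IsProbVec m ∧ (∀ x y, ∑ z, m z * p z y = 0 → p x y = 0) ∧
      ∀ x, ∑ y, p x y * Real.log (p x y) - ∑ y, p x y * Real.log (∑ z, m z * p z y)
        ≤ mutualInfo p m := by
  classical
  obtain ⟨m, hm, hmax⟩ := (isCompact_stdSimplex ℝ X).exists_isMaxOn
    ⟨_, single_mem_stdSimplex ℝ (Classical.arbitrary X)⟩ (continuous_mutualInfo p).continuousOn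
  replace hm : IsProbVec m := hm
  have key (x : X) {t : ℝ} (ht : 0 < t) (ht1 : t ≤ 1) :=
    sum_sub_sum_log_le_of_isMax hp hm (fun l hl ↦ hmax hl) x ht ht1
  have hple (x y) : p x y ≤ 1 :=
    (hp x).2 ▸ Finset.single_le_sum (fun y _ ↦ (hp x).1 y) (Finset.mem_univ y)
  have hr0 (y) : 0 ≤ ∑ z, m z * p z y :=
    Finset.sum_nonneg fun z _ ↦ mul_nonneg (hm.1 z) ((hp z).1 y)
  have hr1 (y) : ∑ z, m z * p z y ≤ 1 :=
    hm.2 ▸ Finset.sum_le_sum fun z _ ↦ mul_le_of_le_one_right (hm.1 z) (hple z y)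
  have hsupp (x y) (h0 : ∑ z, m z * p z y = 0) : p x y = 0 := by
    by_contra hne
    have hpos : 0 < p x y := ((hp x).1 y).lt_of_ne' hne
    set H := ∑ y, p x y * Real.log (p x y)
    set K := mutualInfo p m - H + p x y * Real.log (p x y)
    set s := |K| / p x y + 1
    have hs : 0 < s := by positivity
    have ht1 : Real.exp (-s) ≤ 1 := Real.exp_le_one_iff.2 (by linarith)
    have h := key x (Real.exp_pos (-s)) ht1
    have hle : ∑ y', p x y' * Real.log
        ((1 - Real.exp (-s)) * ∑ z, m z * p z y' + Real.exp (-s) * p x y') ≤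
        p x y * Real.log ((1 - Real.exp (-s)) * ∑ z, m z * p z y + Real.exp (-s) * p x y) := by
      rw [← Finset.add_sum_erase _ _ (Finset.mem_univ y)]
      refine add_le_of_nonpos_right (Finset.sum_nonpos fun y' _ ↦ ?_)
      refine mul_nonpos_of_nonneg_of_nonpos ((hp x).1 y') (Real.log_nonpos ?_ ?_)
      · exact add_nonneg (mul_nonneg (by linarith) (hr0 y'))
          (mul_nonneg (Real.exp_pos _).le ((hp x).1 y'))
      · have h1 := mul_le_of_le_one_right (sub_nonneg.2 ht1) (hr1 y')
        have h2 := mul_le_of_le_one_right (Real.exp_pos (-s)).le (hple x y')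
        linarith
    rw [h0, mul_zero, zero_add, Real.log_mul (Real.exp_pos _).ne' hne, Real.log_exp] at hle
    have hs' : p x y * s = |K| + p x y := by simp only [s]; field_simp
    have := le_abs_self K
    simp only [K] at this hs'
    linarith
  refine ⟨m, hm, hsupp, fun x ↦ ?_⟩
  have hlim : Filter.Tendsto (fun t : ℝ ↦ ∑ y, p x y * Real.log (p x y)
      - ∑ y, p x y * Real.log ((1 - t) * ∑ z, m z * p z y + t * p x y)) (nhdsWithin 0 (Set.Ioi 0))
      (nhds (∑ y, p x y * Real.log (p x y) - ∑ y, p x y * Real.log (∑ z, m z * p z y))) := by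
    refine tendsto_const_nhds.sub (tendsto_finsetSum _ fun y _ ↦ ?_)
    by_cases h0 : ∑ z, m z * p z y = 0
    · simp [hsupp x y h0]
    refine tendsto_nhdsWithin_of_tendsto_nhds (Filter.Tendsto.const_mul _ ?_)
    refine Filter.Tendsto.log ?_ h0
    have : Continuous fun t : ℝ ↦ (1 - t) * ∑ z, m z * p z y + t * p x y := by fun_prop
    simpa using this.tendsto 0
  refine le_of_tendsto hlim ?_
  filter_upwards [Ioc_mem_nhdsGT (zero_lt_one' ℝ)] with t ht
  exact key x ht.1 ht.2

end FiniteAlphabet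

section Atoms

variable {Y : Type*} [MeasurableSpace Y]

/-- A representative of the measurable atom of `y`, depending only on the atom. -/
noncomputable def atomRep (y : Y) : Y :=
  Set.Nonempty.some (s := measurableAtom y) ⟨y, mem_measurableAtom_self y⟩

lemma atomRep_mem (y : Y) : atomRep y ∈ measurableAtom y :=
  Set.Nonempty.some_mem _

lemma atomRep_eq_of_mem {y z : Y} (h : z ∈ measurableAtom y) : atomRep z = atomRep y := by
  unfold atomRep
  congr 1
  exact measurableAtom_eq_of_mem h

lemma atomRep_mem_iff {s : Set Y} (hs : MeasurableSet s) (y : Y) : atomRep y ∈ s ↔ y ∈ s := by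
  refine ⟨fun h ↦ ?_, fun h ↦ measurableAtom_subset hs h (atomRep_mem y)⟩
  by_contra hy
  exact measurableAtom_subset hs.compl hy (atomRep_mem y) h

lemma apply_atomRep {β : Type*} [MeasurableSpace β] [MeasurableSingletonClass β] {f : Y → β}
    (hf : Measurable f) (y : Y) : f (atomRep y) = f y :=
  (atomRep_mem_iff (hf (measurableSet_singleton (f y))) y).2 rfl

lemma measurableSet_atomRep_fiber [Finite Y] (y : Y) : MeasurableSet (atomRep ⁻¹' {y}) := by
  have : atomRep ⁻¹' {y} = ⋃ z ∈ atomRep ⁻¹' {y}, measurableAtom z := by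
    ext w
    simp only [Set.mem_iUnion, Set.mem_preimage, Set.mem_singleton_iff]
    exact ⟨fun h ↦ ⟨w, h, mem_measurableAtom_self w⟩, fun ⟨z, hz, hw⟩ ↦
      (atomRep_eq_of_mem hw).trans hz⟩
  rw [this]
  exact (Set.toFinite _).measurableSet_biUnion fun z _ ↦ MeasurableSet.measurableAtom_of_countable z

lemma apply_eq_of_mem_atomRep_fiber {β : Type*} [MeasurableSpace β] [MeasurableSingletonClass β]
    {f : Y → β} (hf : Measurable f) {y z : Y} (hz : z ∈ atomRep ⁻¹' {y}) : f z = f y := by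
  rw [← apply_atomRep hf z, show atomRep z = y from hz]

lemma iUnion_atomRep_fiber : ⋃ y : Y, atomRep ⁻¹' {y} = Set.univ := by
  ext z
  simp

variable [Fintype Y]

lemma integrable_of_measurable_of_fintype (P : Measure Y) [IsFiniteMeasure P] {f : Y → ℝ}
    (hf : Measurable f) : Integrable f P := by
  refine Integrable.of_bound hf.aestronglyMeasurable (∑ y, ‖f y‖) (Filter.Eventually.of_forall ?_)
  exact fun y ↦ Finset.single_le_sum (fun z _ ↦ norm_nonneg (f z)) (Finset.mem_univ y)

lemma integral_eq_sum_atomRep_fiber (P : Measure Y) [IsFiniteMeasure P] {f : Y → ℝ}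
    (hf : Measurable f) : ∫ y, f y ∂P = ∑ y, P.real (atomRep ⁻¹' {y}) * f y := by
  have hint := integrable_of_measurable_of_fintype P hf
  rw [← setIntegral_univ, ← iUnion_atomRep_fiber, integral_iUnion_fintype measurableSet_atomRep_fiber
    (fun y z h ↦ Disjoint.preimage _ (by simpa using h)) (fun y ↦ hint.integrableOn)]
  refine Finset.sum_congr rfl fun y _ ↦ ?_
  rw [setIntegral_congr_fun (measurableSet_atomRep_fiber y)
    (fun z hz ↦ apply_eq_of_mem_atomRep_fiber hf hz), setIntegral_const, smul_eq_mul]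

lemma isProbVec_atomRep_fiber (P : Measure Y) [IsProbabilityMeasure P] :
    IsProbVec fun y ↦ P.real (atomRep ⁻¹' {y}) := by
  refine ⟨fun y ↦ measureReal_nonneg, ?_⟩
  simpa using (integral_eq_sum_atomRep_fiber P (measurable_const (a := (1 : ℝ)))).symm

lemma absolutelyContinuous_of_atomRep_fiber {P Q : Measure Y} [IsFiniteMeasure P]
    (h : ∀ y, Q.real (atomRep ⁻¹' {y}) = 0 → P.real (atomRep ⁻¹' {y}) = 0) : P ≪ Q := by
  refine Measure.AbsolutelyContinuous.mk fun s hs hQ ↦ ?_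
  have hsub : s ⊆ ⋃ y ∈ s, atomRep ⁻¹' {y} := fun z hz ↦
    Set.mem_biUnion ((atomRep_mem_iff hs z).2 hz) rfl
  refine measure_mono_null hsub ((measure_biUnion_null_iff (Set.to_countable s)).2 fun y hy ↦ ?_)
  have hys : atomRep ⁻¹' {y} ⊆ s := fun z hz ↦
    (atomRep_mem_iff hs z).1 (show atomRep z ∈ s from (show atomRep z = y from hz) ▸ hy)
  have := h y (by simp [measureReal_def, measure_mono_null hys hQ])
  rwa [measureReal_eq_zero_iff] at this

/-- On a finite space, the divergence is the usual finite sum over atoms. -/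
lemma klDiv_eq_sum_atomRep_fiber {P Q : Measure Y} [IsFiniteMeasure P] [IsFiniteMeasure Q]
    (h : ∀ y, Q.real (atomRep ⁻¹' {y}) = 0 → P.real (atomRep ⁻¹' {y}) = 0) :
    klDiv P Q = ((∑ y, P.real (atomRep ⁻¹' {y}) * Real.log (P.real (atomRep ⁻¹' {y}))
      - ∑ y, P.real (atomRep ⁻¹' {y}) * Real.log (Q.real (atomRep ⁻¹' {y})) : ℝ) : EReal) := by
  have hac := absolutelyContinuous_of_atomRep_fiber h
  have hmeas : Measurable (llr P Q) := measurable_llr P Q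
  rw [klDiv, if_pos ⟨hac, integrable_of_measurable_of_fintype P hmeas⟩,
    integral_eq_sum_atomRep_fiber P hmeas, ← Finset.sum_sub_distrib]
  congr 1
  refine Finset.sum_congr rfl fun y _ ↦ ?_
  by_cases hP : P.real (atomRep ⁻¹' {y}) = 0
  · simp [hP]
  have hQ : Q.real (atomRep ⁻¹' {y}) ≠ 0 := fun h0 ↦ hP (h y h0)
  have hfib : (P.rnDeriv Q y).toReal * Q.real (atomRep ⁻¹' {y}) = P.real (atomRep ⁻¹' {y}) := by
    rw [measureReal_def, measureReal_def, ← Measure.setLIntegral_rnDeriv hac,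
      setLIntegral_congr_fun (measurableSet_atomRep_fiber y)
        (fun z hz ↦ apply_eq_of_mem_atomRep_fiber (Measure.measurable_rnDeriv P Q) hz),
      setLIntegral_const, ENNReal.toReal_mul]
  rw [llr, eq_div_of_mul_eq hQ hfib, Real.log_div hP hQ, mul_sub]

end Atoms

lemma measureReal_sum_ofReal_smul {X Y : Type*} [Fintype X] [MeasurableSpace Y] (E : X → Measure Y)
    [∀ x, IsFiniteMeasure (E x)] {m : X → ℝ} (hm : ∀ x, 0 ≤ m x) (s : Set Y) :
    (∑ x, ENNReal.ofReal (m x) • E x).real s = ∑ x, m x * (E x).real s := by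
  rw [measureReal_def, Measure.finsetSum_apply, ENNReal.toReal_sum]
  · refine Finset.sum_congr rfl fun x _ ↦ ?_
    simp [measureReal_def, ENNReal.toReal_ofReal (hm x)]
  · intro x _
    simpa using ENNReal.mul_ne_top ENNReal.ofReal_ne_top (measure_ne_top (E x) s)

lemma EReal.coe_sum_real {ι : Type*} (s : Finset ι) (f : ι → ℝ) :
    ((∑ i ∈ s, f i : ℝ) : EReal) = ∑ i ∈ s, (f i : EReal) :=
  map_sum (⟨⟨Real.toEReal, EReal.coe_zero⟩, EReal.coe_add⟩ : ℝ →+ EReal) f s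

/-- There is a distribution `μ` such that every `klDiv(E(x)‖ρ_μ)` is bounded by the
maximum possible information `T(E)`. -/
theorem stmt_1 {X Y : Type*} [Fintype X] [Nonempty X] [Fintype Y] [Nonempty Y]
    [MeasurableSpace Y]
    (E : X → Measure Y) (hE : ∀ x, IsProbabilityMeasure (E x)) :
    ∃ μ : X → ℝ, IsProbVec μ ∧
      ∀ x, klDiv (E x) (∑ y, ENNReal.ofReal (μ y) • E y) ≤
        ⨆ lam : {l : X → ℝ // IsProbVec l},
          ∑ x, ((lam.1 x : ℝ) : EReal) * klDiv (E x) (∑ y, ENNReal.ofReal (lam.1 y) • E y) := by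
  obtain ⟨m, hm, hsupp, hle⟩ := exists_isProbVec_divergence_le
    (fun x ↦ isProbVec_atomRep_fiber (E x))
  have hfin : IsFiniteMeasure (∑ x, ENNReal.ofReal (m x) • E x) := by
    refine ⟨?_⟩
    rw [Measure.finsetSum_apply]
    refine ENNReal.sum_lt_top.2 fun x _ ↦ ?_
    simp
  have hkl (x : X) := klDiv_eq_sum_atomRep_fiber (P := E x)
    (Q := ∑ x, ENNReal.ofReal (m x) • E x) fun y hy ↦
      hsupp x y (by rwa [measureReal_sum_ofReal_smul E hm.1] at hy)
  simp only [measureReal_sum_ofReal_smul E hm.1] at hkl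
  refine ⟨m, hm, fun x ↦ le_iSup_of_le ⟨m, hm⟩ ?_⟩
  simp only [hkl, ← EReal.coe_mul, ← EReal.coe_sum_real]
  rw [mutualInfo_eq_sum_mul] at hle
  exact EReal.coe_le_coe_iff.2 (hle x)
end

section
/- Let X be a finite nonempty set, let E : X → { positive definite density matrices on ℂ^d }, and let μ be any probability distribution on X. Then Σ_{x∈X} μ(x)·S(E(x) ‖ ρ_μ) ≤ log d, where ρ_μ = Σ_{x∈X} μ(x)·E(x). In particular, the maximum possible information T(E) = sup over μ of Σ_x μ(x)·S(E(x)‖ρ_μ) satisfies T(E) ≤ log d. -/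
open Matrix
open scoped ComplexOrder

theorem Matrix.IsHermitian.trace_mul_matLog {n : Type*} [Fintype n] [DecidableEq n]
    {A : Matrix n n ℂ} (hA : A.IsHermitian) :
    (A * matLog A).trace.re = ∑ i, hA.eigenvalues i * Real.log (hA.eigenvalues i) := by
  have hmul : A * matLog A = cfc (fun x : ℝ => x * Real.log x) A := by
    have hlog : ContinuousOn Real.log (spectrum ℝ A) := by
      rw [continuousOn_iff_continuous_domRestrict]
      fun_prop
    rw [cfc_mul (fun x : ℝ => x) Real.log A continuousOn_id hlog, cfc_id' ℝ A hA.isSelfAdjoint, matLog]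
  rw [hmul, hA.cfc_eq, IsHermitian.cfc, Unitary.conjStarAlgAut_apply, trace_mul_comm, ← mul_assoc]
  simp [trace_diagonal]

theorem Matrix.IsHermitian.sum_eigenvalues_eq_one {n : Type*} [Fintype n] [DecidableEq n]
    {A : Matrix n n ℂ} (hA : A.IsHermitian) (htr : A.trace = 1) :
    ∑ i, hA.eigenvalues i = 1 := by
  have h := hA.trace_eq_sum_eigenvalues
  rw [htr] at h
  apply Complex.ofReal_injective
  simpa using h.symm

/-- The von Neumann entropy of a density matrix is nonnegative. -/
theorem Matrix.PosSemidef.trace_mul_matLog_nonpos {n : Type*} [Fintype n] [DecidableEq n]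
    {A : Matrix n n ℂ} (hA : A.PosSemidef) (htr : A.trace = 1) :
    (A * matLog A).trace.re ≤ 0 := by
  rw [hA.isHermitian.trace_mul_matLog]
  refine Finset.sum_nonpos fun i _ => ?_
  have hle : hA.isHermitian.eigenvalues i ≤ 1 := by
    rw [← hA.isHermitian.sum_eigenvalues_eq_one htr]
    exact Finset.single_le_sum (fun j _ => hA.eigenvalues_nonneg j) (Finset.mem_univ i)
  exact mul_nonpos_of_nonneg_of_nonpos (hA.eigenvalues_nonneg i)
    (Real.log_nonpos (hA.eigenvalues_nonneg i) hle)

/-- The von Neumann entropy of a density matrix is at most the logarithm of the dimension. -/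
theorem Matrix.PosSemidef.neg_trace_mul_matLog_le {n : Type*} [Fintype n] [DecidableEq n]
    {A : Matrix n n ℂ} (hA : A.PosSemidef) (htr : A.trace = 1) :
    -(A * matLog A).trace.re ≤ Real.log (Fintype.card n) := by
  have hsum := hA.isHermitian.sum_eigenvalues_eq_one htr
  have hn : Nonempty n := by
    by_contra h
    rw [not_nonempty_iff] at h
    simp at hsum
  have hc : (0 : ℝ) < Fintype.card n := by exact_mod_cast Fintype.card_pos
  rw [hA.isHermitian.trace_mul_matLog]
  have key : ∀ i, -(hA.isHermitian.eigenvalues i * Real.log (hA.isHermitian.eigenvalues i)) ≤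
      hA.isHermitian.eigenvalues i * Real.log (Fintype.card n) +
        ((Fintype.card n : ℝ)⁻¹ - hA.isHermitian.eigenvalues i) := by
    intro i
    rcases (hA.eigenvalues_nonneg i).eq_or_lt with h | h
    · rw [← h]
      simp
    · have hlog := Real.log_le_sub_one_of_pos
        (inv_pos.mpr (mul_pos hc h))
      rw [Real.log_inv, Real.log_mul hc.ne' h.ne'] at hlog
      have hmul := mul_le_mul_of_nonneg_left hlog h.le
      have hcancel : hA.isHermitian.eigenvalues i *
          ((Fintype.card n : ℝ) * hA.isHermitian.eigenvalues i)⁻¹ = (Fintype.card n : ℝ)⁻¹ := by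
        field_simp
      rw [mul_sub, hcancel] at hmul
      linarith
  calc -∑ i, hA.isHermitian.eigenvalues i * Real.log (hA.isHermitian.eigenvalues i)
      = ∑ i, -(hA.isHermitian.eigenvalues i * Real.log (hA.isHermitian.eigenvalues i)) := by
        rw [Finset.sum_neg_distrib]
    _ ≤ ∑ i, (hA.isHermitian.eigenvalues i * Real.log (Fintype.card n) +
        ((Fintype.card n : ℝ)⁻¹ - hA.isHermitian.eigenvalues i)) :=
        Finset.sum_le_sum fun i _ => key i
    _ = Real.log (Fintype.card n) := by
        rw [Finset.sum_add_distrib, Finset.sum_sub_distrib, ← Finset.sum_mul, hsum]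
        simp [hc.ne']

/-- The average relative entropy to the mixture is the Holevo quantity. -/
theorem sum_mul_qRelEnt_mixture {n X : Type*} [Fintype n] [DecidableEq n] [Fintype X]
    (E : X → Matrix n n ℂ) (μ : X → ℝ) :
    ∑ x, μ x * qRelEnt (E x) (∑ y, μ y • E y) =
      ∑ x, μ x * (E x * matLog (E x)).trace.re -
        ((∑ y, μ y • E y) * matLog (∑ y, μ y • E y)).trace.re := by
  generalize hL : matLog (∑ y, μ y • E y) = L
  simp [qRelEnt, hL, mul_sub, Finset.sum_mul, trace_sum]

theorem sum_mul_qRelEnt_mixture_le {n X : Type*} [Fintype n] [DecidableEq n] [Fintype X]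
    (E : X → Matrix n n ℂ) (hE : ∀ x, (E x).PosSemidef) (htr : ∀ x, (E x).trace = 1)
    (μ : X → ℝ) (hμ : IsProbVec μ) :
    ∑ x, μ x * qRelEnt (E x) (∑ y, μ y • E y) ≤ Real.log (Fintype.card n) := by
  have hρ : (∑ y, μ y • E y).PosSemidef :=
    posSemidef_sum _ fun x _ => (hE x).smul (hμ.1 x)
  have hρtr : (∑ y, μ y • E y).trace = 1 := by
    simp only [trace_sum, trace_smul, htr, Complex.real_smul, mul_one]
    exact_mod_cast hμ.2
  have hneg : ∑ x, μ x * (E x * matLog (E x)).trace.re ≤ 0 :=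
    Finset.sum_nonpos fun x _ => mul_nonpos_of_nonneg_of_nonpos (hμ.1 x)
      ((hE x).trace_mul_matLog_nonpos (htr x))
  rw [sum_mul_qRelEnt_mixture]
  linarith [hρ.neg_trace_mul_matLog_le hρtr]

/-- Holevo-type bound: the average relative entropy to the mixture, and hence the
maximum possible information `T(E)`, is at most `log d`. -/
theorem stmt_2 {d : ℕ} {X : Type*} [Fintype X] [Nonempty X]
    (E : X → Matrix (Fin d) (Fin d) ℂ)
    (hpd : ∀ x, (E x).PosDef) (htr : ∀ x, (E x).trace = 1)
    (μ : X → ℝ) (hμ : IsProbVec μ) :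
    (∑ x, μ x * qRelEnt (E x) (∑ y, μ y • E y) ≤ Real.log d) ∧
    (⨆ lam : {l : X → ℝ // IsProbVec l},
        ∑ x, lam.1 x * qRelEnt (E x) (∑ y, lam.1 y • E y)) ≤ Real.log d := by
  have bound : ∀ l : X → ℝ, IsProbVec l →
      ∑ x, l x * qRelEnt (E x) (∑ y, l y • E y) ≤ Real.log d := fun l hl => by
    simpa using sum_mul_qRelEnt_mixture_le E (fun x => (hpd x).posSemidef) htr l hl
  have : Nonempty {l : X → ℝ // IsProbVec l} := ⟨⟨μ, hμ⟩⟩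
  exact ⟨bound μ hμ, ciSup_le fun l => bound l.1 l.2⟩
end

section
/- Quantum relative entropy is convex in its second argument: let ρ be a positive definite density matrix on ℂ^d, let σ_1, …, σ_n be positive definite density matrices on ℂ^d, and let w_1, …, w_n ≥ 0 with Σ_i w_i = 1. Then S(ρ ‖ Σ_i w_i·σ_i) ≤ Σ_i w_i·S(ρ ‖ σ_i). -/
open Matrix
open scoped ComplexOrder

section

open scoped MatrixOrder Matrix.Norms.L2Operator

/-- The trace of a product of two positive semidefinite matrices has nonnegative real part. -/
theorem re_trace_mul_nonneg {n : Type*} [Fintype n] [DecidableEq n]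
    {A B : Matrix n n ℂ} (hA : A.PosSemidef) (hB : B.PosSemidef) :
    0 ≤ (A * B).trace.re := by
  obtain ⟨C, rfl⟩ := CStarAlgebra.nonneg_iff_eq_star_mul_self.mp hA.nonneg
  rw [star_eq_conjTranspose, Matrix.mul_assoc, Matrix.trace_mul_comm]
  exact (Complex.nonneg_iff.mp (hB.mul_mul_conjTranspose_same C).trace_nonneg).1

/-- Operator concavity (Jensen's inequality) for the matrix logarithm. -/
theorem posSemidef_matLog_sum_sub {n ι : Type*} [Fintype n] [DecidableEq n] [Fintype ι]
    (σ : ι → Matrix n n ℂ) (hσ : ∀ i, (σ i).PosDef)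
    (w : ι → ℝ) (hw : ∀ i, 0 ≤ w i) (hw1 : ∑ i, w i = 1) :
    (matLog (∑ i, w i • σ i) - ∑ i, w i • matLog (σ i)).PosSemidef :=
  Matrix.le_iff.mp <| (CFC.concaveOn_log (A := Matrix n n ℂ)).le_map_sum
    (fun i _ => hw i) hw1 (fun i _ => (hσ i).isStrictlyPositive)

end

/-- Quantum relative entropy is convex in its second argument. -/
theorem stmt_4 {d n : ℕ}
    (ρ : Matrix (Fin d) (Fin d) ℂ) (hρ : ρ.PosDef) (hρtr : ρ.trace = 1)
    (σ : Fin n → Matrix (Fin d) (Fin d) ℂ)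
    (hσ : ∀ i, (σ i).PosDef) (hσtr : ∀ i, (σ i).trace = 1)
    (w : Fin n → ℝ) (hw : ∀ i, 0 ≤ w i) (hw1 : ∑ i, w i = 1) :
    qRelEnt ρ (∑ i, w i • σ i) ≤ ∑ i, w i * qRelEnt ρ (σ i) := by
  have key := re_trace_mul_nonneg hρ.posSemidef (posSemidef_matLog_sum_sub σ hσ w hw hw1)
  have expand : ∑ i, w i * qRelEnt ρ (σ i) =
      (ρ * matLog ρ).trace.re - (ρ * ∑ i, w i • matLog (σ i)).trace.re := by
    simp [qRelEnt, Matrix.mul_sum, Matrix.trace_sum, mul_sub,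
      Finset.sum_sub_distrib, ← Finset.sum_mul, hw1]
  rw [expand]
  simp only [qRelEnt, Matrix.mul_sub, Matrix.trace_sub, Complex.sub_re] at key ⊢
  linarith
end
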